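/- Let $\mathcal{O} \subset \mathbb{R}^d$ be a bounded domain of class $C^1$, and for $\varepsilon > 0$ let $B_\varepsilon = \{\mathbf{x} \in \mathcal{O} : \mathrm{dist}(\mathbf{x}, \partial\mathcal{O}) < \varepsilon\}$. Then there exist $\varepsilon_0 \in (0,1]$ and a constant $\beta > 0$, both depending only on $\mathcal{O}$, such that for all $u \in H^1(\mathcal{O})$ and all $0 < \varepsilon \le \varepsilon_0$, $\int_{B_\varepsilon} |u|^2\,d\mathbf{x} \le \beta\varepsilon\,\|u\|_{H^1(\mathcal{O})}\|u\|_{L_2(\mathcal{O})}$. -/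

import Mathlib

open MeasureTheory

noncomputable section

/-- A bounded domain of class `C¹` in `ℝ^{d+1}`: a nonempty bounded open set
whose boundary is locally, after a rigid rotation (linear isometry), the graph
of a `C¹` function, with the domain locally lying on one side of the graph. -/
def IsC1Domain {d : ℕ} (O : Set (EuclideanSpace ℝ (Fin (d + 1)))) : Prop :=
  IsOpen O ∧ O.Nonempty ∧ Bornology.IsBounded O ∧
  ∀ x ∈ frontier O,
    ∃ (A : EuclideanSpace ℝ (Fin (d + 1)) ≃ₗᵢ[ℝ] EuclideanSpace ℝ (Fin (d + 1)))
      (U : Set (EuclideanSpace ℝ (Fin (d + 1))))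
      (f : EuclideanSpace ℝ (Fin d) → ℝ),
      x ∈ U ∧ IsOpen U ∧ ContDiff ℝ 1 f ∧
      ∀ y ∈ U, (y ∈ O ↔
        f ((WithLp.equiv 2 (Fin d → ℝ)).symm fun i : Fin d => A y i.castSucc) <
          A y (Fin.last d))

/-- Squared norm of the full gradient of a scalar function. -/
def sgradNormSq {d : ℕ} (u : EuclideanSpace ℝ (Fin (d + 1)) → ℂ)
    (x : EuclideanSpace ℝ (Fin (d + 1))) : ℝ :=
  ∑ l, ‖fderiv ℝ u x (EuclideanSpace.single l (1 : ℝ))‖ ^ 2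

/-- A one-dimensional trace inequality: an averaged pointwise bound for a differentiable function
at the left endpoint of an interval. -/
theorem ofReal_le_lintegral_of_hasDerivAt {g g' q : ℝ → ℝ} {T : ℝ} (hT : 0 < T)
    (hg : ∀ s ∈ Set.Icc 0 T, HasDerivAt g (g' s) s) (hq : Measurable q)
    (hq0 : ∀ s, 0 ≤ q s) (hgq : ∀ s ∈ Set.Icc 0 T, g s / T + |g' s| ≤ q s) :
    ENNReal.ofReal (g 0) ≤ ∫⁻ s in Set.Icc 0 T, ENNReal.ofReal (q s) := by
  by_cases hfin : ∫⁻ s in Set.Icc 0 T, ENNReal.ofReal (q s) = ⊤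
  · simp [hfin]
  have hint : IntegrableOn q (Set.Icc 0 T) :=
    (lintegral_ofReal_ne_top_iff_integrable hq.aestronglyMeasurable
      (Filter.Eventually.of_forall hq0)).1 hfin
  have hderiv : ∀ s ∈ Set.Icc 0 T, HasDerivAt (fun s => -((1 - s / T) * g s))
      (-(-(1 / T) * g s + (1 - s / T) * g' s)) s := fun s hs =>
    ((((hasDerivAt_id s).div_const T).const_sub 1).mul (hg s hs)).neg
  have hmain := intervalIntegral.sub_le_integral_of_hasDeriv_right_of_le hT.le
    (fun s hs => (hderiv s hs).continuousAt.continuousWithinAt)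
    (fun s hs => (hderiv s (Set.Ioo_subset_Icc_self hs)).hasDerivWithinAt) hint (fun s hs => by
      refine le_trans ?_ (hgq s (Set.Ioo_subset_Icc_self hs))
      have h1 : 0 ≤ s / T := div_nonneg hs.1.le hT.le
      have h2 : s / T ≤ 1 := (div_le_one hT).2 hs.2.le
      have h3 : -((1 - s / T) * g' s) ≤ |g' s| := by
        refine (neg_le_abs _).trans ?_
        rw [abs_mul, abs_of_nonneg (by linarith)]
        exact mul_le_of_le_one_left (abs_nonneg _) (by linarith)
      have h4 : 1 / T * g s = g s / T := by ring
      linarith)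
  rw [intervalIntegral.integral_of_le hT.le, ← integral_Icc_eq_integral_Ioc] at hmain
  rw [← ofReal_integral_eq_lintegral_ofReal hint (Filter.Eventually.of_forall hq0)]
  refine ENNReal.ofReal_le_ofReal ?_
  simpa [div_self hT.ne'] using hmain

/-- If every line in direction `e` meets `S` in a set of length at most `c`, then integrating `k`
along segments in direction `e` issuing from `S` costs at most `c` times the integral of `k`. -/
theorem setLIntegral_lintegral_add_smul_le {E : Type*} [NormedAddCommGroup E] [NormedSpace ℝ E]
    [MeasurableSpace E] [BorelSpace E] [SecondCountableTopology E]
    (μ : Measure E) [μ.IsAddHaarMeasure] [SFinite μ]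
    {S : Set E} (hS : MeasurableSet S) (I : Set ℝ) (e : E) {c : ENNReal}
    (hc : ∀ z, volume {s : ℝ | z - s • e ∈ S} ≤ c) {k : E → ENNReal} (hk : Measurable k) :
    ∫⁻ y in S, (∫⁻ s in I, k (y + s • e)) ∂μ ≤ c * ∫⁻ z, k z ∂μ := by
  have hshift : Measurable fun p : ℝ × E => p.2 - p.1 • e := by fun_prop
  have hind : Measurable (S.indicator (1 : E → ENNReal)) := measurable_one.indicator hS
  calc ∫⁻ y in S, (∫⁻ s in I, k (y + s • e)) ∂μ
      = ∫⁻ s in I, ∫⁻ y in S, k (y + s • e) ∂μ := by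
        rw [lintegral_lintegral_swap]
        exact Measurable.aemeasurable (hk.comp
          (by fun_prop : Measurable fun p : E × ℝ => p.1 + p.2 • e))
    _ = ∫⁻ s in I, ∫⁻ z, S.indicator 1 (z - s • e) * k z ∂μ := by
        congr 1 with s
        rw [← lintegral_add_right_eq_self (fun z => S.indicator 1 (z - s • e) * k z) (s • e),
          ← lintegral_indicator hS]
        congr 1 with y
        by_cases hy : y ∈ S <;> simp [hy]
    _ ≤ ∫⁻ s, ∫⁻ z, S.indicator 1 (z - s • e) * k z ∂μ := setLIntegral_le_lintegral _ _
    _ = ∫⁻ z, (∫⁻ s : ℝ, S.indicator 1 (z - s • e) * k z) ∂μ := by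
        rw [lintegral_lintegral_swap]
        exact ((hind.comp hshift).mul (hk.comp measurable_snd)).aemeasurable
    _ ≤ ∫⁻ z, c * k z ∂μ := by
        refine lintegral_mono fun z => ?_
        have hz : Measurable fun s : ℝ => z - s • e := by fun_prop
        rw [lintegral_mul_const (k z) (f := fun s : ℝ => S.indicator 1 (z - s • e)) (hind.comp hz)]
        gcongr
        exact le_trans (le_of_eq (lintegral_indicator_one (hz hS))) (hc z)
    _ = c * ∫⁻ z, k z ∂μ := lintegral_const_mul _ hk

theorem sgradNormSq_nonneg {d : ℕ} (u : EuclideanSpace ℝ (Fin (d + 1)) → ℂ)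
    (x : EuclideanSpace ℝ (Fin (d + 1))) : 0 ≤ sgradNormSq u x :=
  Finset.sum_nonneg fun _ _ => by positivity

theorem measurable_sgradNormSq {d : ℕ} (u : EuclideanSpace ℝ (Fin (d + 1)) → ℂ) :
    Measurable (sgradNormSq u) := by
  unfold sgradNormSq
  exact Finset.measurable_fun_sum _ fun l _ =>
    ((measurable_fderiv_apply_const ℝ u _).norm.pow_const 2)

theorem norm_fderiv_apply_le {d : ℕ} (u : EuclideanSpace ℝ (Fin (d + 1)) → ℂ)
    (x e : EuclideanSpace ℝ (Fin (d + 1))) :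
    ‖fderiv ℝ u x e‖ ≤ ‖e‖ * √(sgradNormSq u x) := by
  have he : e = ∑ l, e l • EuclideanSpace.single l (1 : ℝ) := by
    simpa using ((EuclideanSpace.basisFun (Fin (d + 1)) ℝ).sum_repr e).symm
  calc ‖fderiv ℝ u x e‖
      = ‖∑ l, e l • fderiv ℝ u x (EuclideanSpace.single l (1 : ℝ))‖ := by
        conv_lhs => rw [he]
        simp only [map_sum, map_smul]
    _ ≤ ∑ l, ‖e l‖ * ‖fderiv ℝ u x (EuclideanSpace.single l (1 : ℝ))‖ := by
        refine (norm_sum_le _ _).trans (Finset.sum_le_sum fun l _ => ?_)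
        rw [norm_smul]
    _ ≤ √(∑ l, ‖e l‖ ^ 2) * √(sgradNormSq u x) := Real.sum_mul_le_sqrt_mul_sqrt _ _ _
    _ = ‖e‖ * √(sgradNormSq u x) := by rw [EuclideanSpace.norm_eq]

/-- The density `|u|² + |u| |∇u|`, extended by zero outside `O`. -/
def traceDensity {d : ℕ} (O : Set (EuclideanSpace ℝ (Fin (d + 1))))
    (u : EuclideanSpace ℝ (Fin (d + 1)) → ℂ) : EuclideanSpace ℝ (Fin (d + 1)) → ℝ :=
  O.indicator fun x => ‖u x‖ ^ 2 + ‖u x‖ * √(sgradNormSq u x)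

theorem traceDensity_nonneg {d : ℕ} (O : Set (EuclideanSpace ℝ (Fin (d + 1))))
    (u : EuclideanSpace ℝ (Fin (d + 1)) → ℂ) (x : EuclideanSpace ℝ (Fin (d + 1))) :
    0 ≤ traceDensity O u x :=
  Set.indicator_nonneg (fun _ _ => by positivity) x

theorem measurable_traceDensity {d : ℕ} {O : Set (EuclideanSpace ℝ (Fin (d + 1)))}
    (hO : IsOpen O) {u : EuclideanSpace ℝ (Fin (d + 1)) → ℂ} (hu : ContinuousOn u O) :
    Measurable (traceDensity O u) := by
  have h0 : Measurable (O.indicator u) := by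
    classical
    rw [← Set.piecewise_eq_indicator]
    exact hu.measurable_piecewise continuousOn_const hO.measurableSet
  have h1 : traceDensity O u = fun x => ‖O.indicator u x‖ ^ 2 +
      ‖O.indicator u x‖ * √(sgradNormSq u x) := by
    ext x
    by_cases hx : x ∈ O <;> simp [traceDensity, hx]
  rw [h1]
  exact (h0.norm.pow_const 2).add (h0.norm.mul (measurable_sgradNormSq u).sqrt)

/-- Segment version of the trace inequality. -/
theorem ofReal_norm_sq_le_lintegral_traceDensity {d : ℕ}
    {O : Set (EuclideanSpace ℝ (Fin (d + 1)))} (hO : IsOpen O)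
    {u : EuclideanSpace ℝ (Fin (d + 1)) → ℂ} (hu : ∀ x ∈ O, DifferentiableAt ℝ u x)
    {e y : EuclideanSpace ℝ (Fin (d + 1))} (he : ‖e‖ = 1) {T : ℝ} (hT : 0 < T)
    (hy : ∀ s ∈ Set.Icc 0 T, y + s • e ∈ O) :
    ENNReal.ofReal (‖u y‖ ^ 2) ≤
      ∫⁻ s in Set.Icc 0 T, ENNReal.ofReal ((1 / T + 2) * traceDensity O u (y + s • e)) := by
  have hcont : ContinuousOn u O := fun x hx => (hu x hx).continuousAt.continuousWithinAt
  have hline : ∀ s : ℝ, HasDerivAt (fun s : ℝ => y + s • e) e s := fun s => by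
    simpa using ((hasDerivAt_id s).smul_const e).const_add y
  have hmeas : Measurable fun s : ℝ => y + s • e := by fun_prop
  have := ofReal_le_lintegral_of_hasDerivAt (g := fun s => ‖u (y + s • e)‖ ^ 2)
    (q := fun s => (1 / T + 2) * traceDensity O u (y + s • e)) hT
    (fun s hs => ((hu _ (hy s hs)).hasFDerivAt.comp_hasDerivAt s (hline s)).norm_sq)
    (((measurable_traceDensity hO hcont).comp hmeas).const_mul _)
    (fun s => mul_nonneg (by positivity) (traceDensity_nonneg O u _))
    (fun s hs => by
      have h1 : |2 * inner ℝ (u (y + s • e)) (fderiv ℝ u (y + s • e) e)| ≤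
          2 * (‖u (y + s • e)‖ * √(sgradNormSq u (y + s • e))) := by
        rw [abs_mul, abs_two]
        have h2 := norm_fderiv_apply_le u (y + s • e) e
        rw [he, one_mul] at h2
        gcongr
        exact (abs_real_inner_le_norm _ _).trans (by gcongr)
      have h3 : traceDensity O u (y + s • e) =
          ‖u (y + s • e)‖ ^ 2 + ‖u (y + s • e)‖ * √(sgradNormSq u (y + s • e)) :=
        Set.indicator_of_mem (hy s hs) _
      have h4 : 0 ≤ 1 / T * (‖u (y + s • e)‖ * √(sgradNormSq u (y + s • e))) := by positivity
      have h5 : 0 ≤ ‖u (y + s • e)‖ ^ 2 := by positivity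
      simp only [Function.comp_apply]
      rw [h3, div_eq_mul_one_div]
      nlinarith)
  simpa using this

/-- Around a boundary point, a `C¹` domain is a positivity set of a Lipschitz function that grows
with unit speed along a fixed unit direction. -/
theorem IsC1Domain.exists_local_height {d : ℕ} {O : Set (EuclideanSpace ℝ (Fin (d + 1)))}
    (hO : IsC1Domain O) {x : EuclideanSpace ℝ (Fin (d + 1))} (hx : x ∈ frontier O) :
    ∃ (e : EuclideanSpace ℝ (Fin (d + 1))) (ρ : EuclideanSpace ℝ (Fin (d + 1)) → ℝ) (K r : ℝ),
      ‖e‖ = 1 ∧ 0 < K ∧ 0 < r ∧ (∀ y s, ρ (y + s • e) = ρ y + s) ∧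
      (∀ y ∈ Metric.ball x r, ∀ z ∈ Metric.ball x r, ρ y - ρ z ≤ K * dist y z) ∧
      ∀ y ∈ Metric.ball x r, (y ∈ O ↔ 0 < ρ y) := by
  obtain ⟨A, U, f, hxU, hU, hf, hUO⟩ := hO.2.2.2 x hx
  let ρ : EuclideanSpace ℝ (Fin (d + 1)) → ℝ := fun y => A y (Fin.last d) -
    f ((WithLp.equiv 2 (Fin d → ℝ)).symm fun i : Fin d => A y i.castSucc)
  have hcoord : ∀ i, ContDiff ℝ 1 fun y => A y i := fun i =>
    (contDiff_euclidean.1 A.contDiff) i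
  have hρ : ContDiff ℝ 1 ρ :=
    (hcoord _).sub (hf.comp (contDiff_euclidean.2 fun i => hcoord i.castSucc))
  obtain ⟨K, t, ht, hK⟩ := hρ.contDiffAt.exists_lipschitzOnWith (x := x)
  obtain ⟨r, hr, hrt⟩ := Metric.mem_nhds_iff.1 (Filter.inter_mem ht (hU.mem_nhds hxU))
  refine ⟨A.symm (EuclideanSpace.single (Fin.last d) 1), ρ, K + 1, r, by simp, by positivity, hr,
    fun y s => ?_, fun y hy z hz => ?_, fun y hy => ?_⟩
  · have h1 : ∀ i : Fin d, i.castSucc ≠ Fin.last d := fun i => (Fin.castSucc_lt_last i).ne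
    simp [ρ, h1]
    ring
  · have := hK.dist_le_mul y (hrt hy).1 z (hrt hz).1
    rw [Real.dist_eq] at this
    have := (le_abs_self _).trans this
    nlinarith [dist_nonneg (x := y) (y := z)]
  · rw [hUO y (hrt hy).2, sub_pos]

/-- The part of `O` at distance less than `ε` from its boundary. -/
def boundaryStrip {d : ℕ} (O : Set (EuclideanSpace ℝ (Fin (d + 1)))) (ε : ℝ) :
    Set (EuclideanSpace ℝ (Fin (d + 1))) :=
  {x ∈ O | Metric.infDist x (frontier O) < ε}

theorem measurableSet_boundaryStrip {d : ℕ} {O : Set (EuclideanSpace ℝ (Fin (d + 1)))}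
    (hO : IsOpen O) (ε : ℝ) : MeasurableSet (boundaryStrip O ε) :=
  (hO.inter (isOpen_lt (Metric.continuous_infDist_pt _) continuous_const)).measurableSet

/-- The boundary strip estimate holds on `N` with constant `C` for strips of width at most `δ`. -/
def StripBound {d : ℕ} (O N : Set (EuclideanSpace ℝ (Fin (d + 1)))) (C δ : ℝ) : Prop :=
  ∀ u : EuclideanSpace ℝ (Fin (d + 1)) → ℂ, (∀ x ∈ O, DifferentiableAt ℝ u x) →
    ∀ ε, 0 < ε → ε ≤ δ →
      ∫⁻ x in boundaryStrip O ε ∩ N, ENNReal.ofReal (‖u x‖ ^ 2) ≤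
        ENNReal.ofReal (C * ε) * ∫⁻ x, ENNReal.ofReal (traceDensity O u x)

theorem IsC1Domain.exists_local_stripBound {d : ℕ} {O : Set (EuclideanSpace ℝ (Fin (d + 1)))}
    (hO : IsC1Domain O) {x : EuclideanSpace ℝ (Fin (d + 1))} (hx : x ∈ frontier O) :
    ∃ r C δ : ℝ, 0 < r ∧ 0 < C ∧ 0 < δ ∧ StripBound O (Metric.ball x r) C δ := by
  obtain ⟨e, ρ, K, r, he, hK, hr, hρ, hlip, hpos⟩ := hO.exists_local_height hx
  have hsub : Metric.ball x (r / 2) ⊆ Metric.ball x r := Metric.ball_subset_ball (by linarith)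
  have hT : 0 < r / 4 := by positivity
  refine ⟨r / 2, (1 / (r / 4) + 2) * K, r / 2, by positivity, by positivity, by positivity,
    fun u hu ε hε hεr => ?_⟩
  have hcont : ContinuousOn u O := fun x hx => (hu x hx).continuousAt.continuousWithinAt
  have hmeas := measurable_traceDensity hO.1 hcont
  have hS : MeasurableSet (boundaryStrip O ε ∩ Metric.ball x (r / 2)) :=
    (measurableSet_boundaryStrip hO.1 ε).inter Metric.isOpen_ball.measurableSet
  have hheight : ∀ y ∈ boundaryStrip O ε ∩ Metric.ball x (r / 2), 0 < ρ y ∧ ρ y < K * ε := by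
    rintro y ⟨⟨hyO, hyε⟩, hyr⟩
    refine ⟨(hpos y (hsub hyr)).1 hyO, ?_⟩
    obtain ⟨p, hp, hyp⟩ := (Metric.infDist_lt_iff ⟨x, hx⟩).1 hyε
    have hpr : p ∈ Metric.ball x r := by
      rw [Metric.mem_ball] at hyr ⊢
      have := dist_triangle_left p x y
      linarith
    have hpO : p ∉ O := by
      rw [hO.1.frontier_eq] at hp
      exact hp.2
    have h1 := hlip y (hsub hyr) p hpr
    have h2 : ρ p ≤ 0 := not_lt.1 fun h => hpO ((hpos p hpr).2 h)
    have h3 := mul_lt_mul_of_pos_left hyp hK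
    linarith
  have hseg : ∀ y ∈ boundaryStrip O ε ∩ Metric.ball x (r / 2), ∀ s ∈ Set.Icc 0 (r / 4),
      y + s • e ∈ O := by
    intro y hy s hs
    refine (hpos _ ?_).2 ?_
    · have h1 := hy.2
      rw [Metric.mem_ball] at h1 ⊢
      have h2 : dist (y + s • e) y = s := by
        simp [dist_eq_norm, norm_smul, he, abs_of_nonneg hs.1]
      have h3 := dist_triangle (y + s • e) y x
      linarith [hs.2]
    · rw [hρ]
      linarith [(hheight y hy).1, hs.1]
  have hlen : ∀ z, volume {s : ℝ | z - s • e ∈ boundaryStrip O ε ∩ Metric.ball x (r / 2)} ≤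
      ENNReal.ofReal (K * ε) := by
    intro z
    calc _ ≤ volume (Set.Ioo (ρ z - K * ε) (ρ z)) := by
          refine measure_mono fun s hs => ?_
          have h1 := hheight _ hs
          have h2 := hρ z (-s)
          rw [neg_smul, ← sub_eq_add_neg] at h2
          rw [h2] at h1
          exact ⟨by linarith, by linarith⟩
      _ = ENNReal.ofReal (K * ε) := by simp
  calc ∫⁻ y in boundaryStrip O ε ∩ Metric.ball x (r / 2), ENNReal.ofReal (‖u y‖ ^ 2)
      ≤ ∫⁻ y in boundaryStrip O ε ∩ Metric.ball x (r / 2), ∫⁻ s in Set.Icc 0 (r / 4),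
          ENNReal.ofReal ((1 / (r / 4) + 2) * traceDensity O u (y + s • e)) :=
        setLIntegral_mono' hS fun y hy =>
          ofReal_norm_sq_le_lintegral_traceDensity hO.1 hu he hT (hseg y hy)
    _ ≤ ENNReal.ofReal (K * ε) *
          ∫⁻ z, ENNReal.ofReal ((1 / (r / 4) + 2) * traceDensity O u z) :=
        setLIntegral_lintegral_add_smul_le volume hS _ e hlen (hmeas.const_mul _).ennreal_ofReal
    _ = ENNReal.ofReal ((1 / (r / 4) + 2) * K * ε) *
          ∫⁻ z, ENNReal.ofReal (traceDensity O u z) := by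
        simp_rw [ENNReal.ofReal_mul (show 0 ≤ 1 / (r / 4) + 2 by positivity)]
        rw [lintegral_const_mul _ hmeas.ennreal_ofReal, ← mul_assoc, mul_assoc _ K,
          ENNReal.ofReal_mul (show 0 ≤ 1 / (r / 4) + 2 by positivity),
          mul_comm (ENNReal.ofReal (K * ε))]

theorem StripBound.union {d : ℕ} {O N₁ N₂ : Set (EuclideanSpace ℝ (Fin (d + 1)))}
    {C₁ C₂ δ₁ δ₂ : ℝ} (hC₁ : 0 ≤ C₁) (hC₂ : 0 ≤ C₂) (h₁ : StripBound O N₁ C₁ δ₁)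
    (h₂ : StripBound O N₂ C₂ δ₂) : StripBound O (N₁ ∪ N₂) (C₁ + C₂) (min δ₁ δ₂) := by
  intro u hu ε hε hεδ
  rw [Set.inter_union_distrib_left, add_mul, ENNReal.ofReal_add (by positivity) (by positivity),
    add_mul]
  exact (lintegral_union_le _ _ _).trans (add_le_add
    (h₁ u hu ε hε (hεδ.trans (min_le_left _ _))) (h₂ u hu ε hε (hεδ.trans (min_le_right _ _))))

theorem IsC1Domain.exists_nhdsSet_stripBound {d : ℕ} {O : Set (EuclideanSpace ℝ (Fin (d + 1)))}
    (hO : IsC1Domain O) :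
    ∃ N ∈ nhdsSet (frontier O), ∃ C δ : ℝ, 0 < C ∧ 0 < δ ∧ StripBound O N C δ := by
  have hcomp : IsCompact (frontier O) :=
    Metric.isCompact_of_isClosed_isBounded isClosed_frontier
      (hO.2.2.1.closure.subset frontier_subset_closure)
  refine hcomp.induction_on
    (p := fun s => ∃ N ∈ nhdsSet s, ∃ C δ : ℝ, 0 < C ∧ 0 < δ ∧ StripBound O N C δ)
    ⟨∅, by simp, 1, 1, one_pos, one_pos, fun u _ ε _ _ => by simp⟩
    (fun s t hst ⟨N, hN, h⟩ => ⟨N, nhdsSet_mono hst hN, h⟩) ?_ ?_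
  · rintro s t ⟨N₁, hN₁, C₁, δ₁, hC₁, hδ₁, h₁⟩ ⟨N₂, hN₂, C₂, δ₂, hC₂, hδ₂, h₂⟩
    exact ⟨N₁ ∪ N₂, union_mem_nhdsSet hN₁ hN₂, C₁ + C₂, min δ₁ δ₂, by positivity,
      lt_min hδ₁ hδ₂, h₁.union hC₁.le hC₂.le h₂⟩
  · intro x hx
    obtain ⟨r, C, δ, hr, hC, hδ, h⟩ := hO.exists_local_stripBound hx
    exact ⟨Metric.ball x r, mem_nhdsWithin_of_mem_nhds (Metric.ball_mem_nhds x hr),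
      Metric.ball x r, Metric.isOpen_ball.mem_nhdsSet_self, C, δ, hC, hδ, h⟩

theorem IsC1Domain.exists_stripBound_univ {d : ℕ} {O : Set (EuclideanSpace ℝ (Fin (d + 1)))}
    (hO : IsC1Domain O) : ∃ C δ : ℝ, 0 < C ∧ 0 < δ ∧ StripBound O Set.univ C δ := by
  obtain ⟨N, hN, C, δ, hC, hδ, h⟩ := hO.exists_nhdsSet_stripBound
  have hcomp : IsCompact (frontier O) :=
    Metric.isCompact_of_isClosed_isBounded isClosed_frontier
      (hO.2.2.1.closure.subset frontier_subset_closure)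
  have hne : (frontier O).Nonempty := by
    refine nonempty_frontier_iff.2 ⟨hO.2.1, fun huniv => ?_⟩
    have := hO.2.2.1
    rw [huniv] at this
    exact NormedSpace.unbounded_univ ℝ _ this
  obtain ⟨V, hV, hsub, hVN⟩ := mem_nhdsSet_iff_exists.1 hN
  obtain ⟨η, hη, hthick⟩ := hcomp.exists_thickening_subset_open hV hsub
  refine ⟨C, min δ η, hC, lt_min hδ hη, fun u hu ε hε hεδ => ?_⟩
  have hmem : boundaryStrip O ε ∩ Set.univ ⊆ boundaryStrip O ε ∩ N := by
    refine fun x hx => ⟨hx.1, hVN (hthick ?_)⟩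
    rw [Metric.mem_thickening_iff_infDist_lt hne]
    exact hx.1.2.trans_le (hεδ.trans (min_le_right _ _))
  exact (lintegral_mono_set hmem).trans (h u hu ε hε (hεδ.trans (min_le_left _ _)))

/-- The Cauchy–Schwarz inequality for square-integrable nonnegative functions. -/
theorem integral_mul_le_sqrt_mul_sqrt {α : Type*} [MeasurableSpace α] {μ : Measure α}
    {f g : α → ℝ} (hf0 : ∀ x, 0 ≤ f x) (hg0 : ∀ x, 0 ≤ g x) (hf : AEStronglyMeasurable f μ)
    (hg : AEStronglyMeasurable g μ) (hf2 : Integrable (fun x => f x ^ 2) μ)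
    (hg2 : Integrable (fun x => g x ^ 2) μ) :
    ∫ x, f x * g x ∂μ ≤ √(∫ x, f x ^ 2 ∂μ) * √(∫ x, g x ^ 2 ∂μ) := by
  have := integral_mul_le_Lp_mul_Lq_of_nonneg (μ := μ) Real.HolderConjugate.two_two
    (Filter.Eventually.of_forall hf0) (Filter.Eventually.of_forall hg0)
    (by simpa using (memLp_two_iff_integrable_sq hf).2 hf2)
    (by simpa using (memLp_two_iff_integrable_sq hg).2 hg2)
  simpa [Real.sqrt_eq_rpow] using this

/-- Lemma 5.1: for a bounded `C¹` domain `𝒪` there are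
`ε₀ ∈ (0,1]` and `β > 0`, depending only on `𝒪`, such that for every
`u ∈ H¹(𝒪)` and `0 < ε ≤ ε₀`,
`∫_{B_ε} |u|² ≤ β ε ‖u‖_{H¹(𝒪)} ‖u‖_{L₂(𝒪)}`, where
`B_ε = {x ∈ 𝒪 : dist(x, ∂𝒪) < ε}`. -/
theorem statement8 {d : ℕ} (O : Set (EuclideanSpace ℝ (Fin (d + 1))))
    (hO : IsC1Domain O) :
    ∃ ε₀ : ℝ, 0 < ε₀ ∧ ε₀ ≤ 1 ∧ ∃ β : ℝ, 0 < β ∧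
      ∀ u : EuclideanSpace ℝ (Fin (d + 1)) → ℂ,
        (∀ x ∈ O, DifferentiableAt ℝ u x) →
        IntegrableOn (fun x => ‖u x‖ ^ 2) O →
        IntegrableOn (fun x => sgradNormSq u x) O →
        ∀ ε : ℝ, 0 < ε → ε ≤ ε₀ →
          (∫ x in {x ∈ O | Metric.infDist x (frontier O) < ε}, ‖u x‖ ^ 2) ≤
            β * ε *
              Real.sqrt ((∫ x in O, ‖u x‖ ^ 2) + ∫ x in O, sgradNormSq u x) *
              Real.sqrt (∫ x in O, ‖u x‖ ^ 2) := by
  obtain ⟨C, δ, hC, hδ, h⟩ := hO.exists_stripBound_univ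
  refine ⟨min δ 1, lt_min hδ one_pos, min_le_right _ _, 2 * C, by positivity,
    fun u hu hu2 hgrad ε hε hεδ => ?_⟩
  have hmeas : AEStronglyMeasurable (fun x => ‖u x‖) (volume.restrict O) :=
    (ContinuousOn.aestronglyMeasurable
      (fun x hx => (hu x hx).continuousAt.continuousWithinAt) hO.1.measurableSet).norm
  have hmeas' : AEStronglyMeasurable (fun x => √(sgradNormSq u x)) (volume.restrict O) :=
    (measurable_sgradNormSq u).sqrt.aestronglyMeasurable
  have hsq : ∀ x, √(sgradNormSq u x) ^ 2 = sgradNormSq u x := fun x =>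
    Real.sq_sqrt (sgradNormSq_nonneg u x)
  have hgrad' : Integrable (fun x => √(sgradNormSq u x) ^ 2) (volume.restrict O) := by
    simp only [hsq]
    exact hgrad
  have hprod : IntegrableOn (fun x => ‖u x‖ * √(sgradNormSq u x)) O :=
    ((memLp_two_iff_integrable_sq hmeas).2 hu2).integrable_mul
      ((memLp_two_iff_integrable_sq hmeas').2 hgrad')
  have hcs := integral_mul_le_sqrt_mul_sqrt (fun x => norm_nonneg (u x))
    (fun x => Real.sqrt_nonneg (sgradNormSq u x)) hmeas hmeas' hu2 hgrad'
  simp only [hsq] at hcs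
  have hdens : ∫⁻ x, ENNReal.ofReal (traceDensity O u x) =
      ENNReal.ofReal ((∫ x in O, ‖u x‖ ^ 2) + ∫ x in O, ‖u x‖ * √(sgradNormSq u x)) := by
    rw [← integral_add hu2 hprod, ← integral_indicator hO.1.measurableSet]
    exact (ofReal_integral_eq_lintegral_ofReal
      ((integrable_indicator_iff hO.1.measurableSet).2 (hu2.add hprod))
      (Filter.Eventually.of_forall (traceDensity_nonneg O u))).symm
  have hstrip := h u hu ε hε (hεδ.trans (min_le_left _ _))
  rw [Set.inter_univ, hdens, ← ENNReal.ofReal_mul (by positivity),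
    ← ofReal_integral_eq_lintegral_ofReal (hu2.mono_set fun x hx => hx.1)
      (Filter.Eventually.of_forall fun x => by positivity)] at hstrip
  set a := ∫ x in O, ‖u x‖ ^ 2
  set b := ∫ x in O, sgradNormSq u x
  have ha : 0 ≤ a := integral_nonneg fun x => by positivity
  have hb : 0 ≤ b := integral_nonneg (sgradNormSq_nonneg u)
  have hp : 0 ≤ ∫ x in O, ‖u x‖ * √(sgradNormSq u x) := integral_nonneg fun x => by positivity
  refine ((ENNReal.ofReal_le_ofReal_iff (by positivity)).1 hstrip).trans ?_
  have h1 : √a ≤ √(a + b) := Real.sqrt_le_sqrt (by linarith)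
  have h2 : √b ≤ √(a + b) := Real.sqrt_le_sqrt (by linarith)
  calc C * ε * (a + ∫ x in O, ‖u x‖ * √(sgradNormSq u x))
      ≤ C * ε * (√(a + b) * √a + √(a + b) * √a) := by
        gcongr
        · calc a = √a * √a := (Real.mul_self_sqrt ha).symm
            _ ≤ √(a + b) * √a := by gcongr
        · calc _ ≤ √a * √b := hcs
            _ ≤ √a * √(a + b) := by gcongr
            _ = √(a + b) * √a := mul_comm _ _
    _ = 2 * C * ε * √(a + b) * √a := by ring
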